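/- arXiv:2110.02942 — 2 statements merged into one kernel-verified Lean document; each statement's English description precedes it below -/
import Mathlib

section
/- For every prime power q with q > 2 and integer r ≥ 1, |Sp_{2r}(F_q)| = q^{r²} · ∏_{i=1}^{r} (q^{2i} - 1). -/
open Matrix

section SymplecticFrame

variable {F V : Type*} [Field F] [AddCommGroup V] [Module F V]

/-- A family of `r` mutually orthogonal hyperbolic pairs `(e i, f i)` for the bilinear form `B`. -/
@[ext]
structure SymplecticFrame (B : V →ₗ[F] V →ₗ[F] F) (r : ℕ) where
  e : Fin r → V
  f : Fin r → V
  e_e : ∀ i j, B (e i) (e j) = 0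
  f_f : ∀ i j, B (f i) (f j) = 0
  e_f : ∀ i j, B (e i) (f j) = if i = j then 1 else 0

/-- The vectors `x` with `B u x = 0` and `B v x = 0`. -/
def pairOrthogonal (B : V →ₗ[F] V →ₗ[F] F) (u v : V) : Submodule F V :=
  LinearMap.ker ((B u).prod (B v))

theorem mem_pairOrthogonal {B : V →ₗ[F] V →ₗ[F] F} {u v x : V} :
    x ∈ pairOrthogonal B u v ↔ B u x = 0 ∧ B v x = 0 := by
  simp [pairOrthogonal]

theorem finrank_pairOrthogonal [FiniteDimensional F V] {B : V →ₗ[F] V →ₗ[F] F} (hB : B.IsAlt)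
    {u v : V} (huv : B u v = 1) :
    Module.finrank F (pairOrthogonal B u v) + 2 = Module.finrank F V := by
  have hvu : B v u = -1 := by rw [← hB.neg, huv]
  have hsurj : LinearMap.range ((B u).prod (B v)) = ⊤ := by
    rw [LinearMap.range_eq_top]
    rintro ⟨a, b⟩
    refine ⟨a • v - b • u, ?_⟩
    simp [huv, hvu, hB.self_eq_zero]
  have h := LinearMap.finrank_range_add_finrank_ker ((B u).prod (B v))
  rw [hsurj, finrank_top, Module.finrank_prod, Module.finrank_self] at h
  rw [pairOrthogonal]
  omega

theorem eq_zero_of_pairOrthogonal {B : V →ₗ[F] V →ₗ[F] F} (hB : B.IsAlt)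
    (hnd : ∀ x, (∀ y, B x y = 0) → x = 0) {u v : V} (huv : B u v = 1)
    (x : pairOrthogonal B u v) (hx : ∀ y : pairOrthogonal B u v, B x y = 0) : x = 0 := by
  have hvu : B v u = -1 := by rw [← hB.neg, huv]
  obtain ⟨hux, hvx⟩ := mem_pairOrthogonal.1 x.2
  have hxu : B x u = 0 := by rw [← hB.neg, hux, neg_zero]
  have hxv : B x v = 0 := by rw [← hB.neg, hvx, neg_zero]
  refine Subtype.ext (hnd _ fun y => ?_)
  have hmem : y - B u y • v + B v y • u ∈ pairOrthogonal B u v := by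
    simp [mem_pairOrthogonal, huv, hvu, hB.self_eq_zero]
  simpa [hxu, hxv] using hx ⟨_, hmem⟩

/-- Frames with a prescribed first hyperbolic pair are frames of its orthogonal complement. -/
def SymplecticFrame.fiberEquiv {B : V →ₗ[F] V →ₗ[F] F} (hB : B.IsAlt) {u v : V}
    (huv : B u v = 1) (r : ℕ) :
    {s : SymplecticFrame B (r + 1) // s.e 0 = u ∧ s.f 0 = v} ≃
      SymplecticFrame
        (B.domRestrict₁₂ (pairOrthogonal B u v) (pairOrthogonal B u v)) r where
  toFun s :=
    { e := fun i => ⟨s.1.e i.succ, by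
        obtain ⟨s, rfl, rfl⟩ := s
        rw [mem_pairOrthogonal, s.e_e, ← hB.neg, s.e_f]
        simp⟩
      f := fun i => ⟨s.1.f i.succ, by
        obtain ⟨s, rfl, rfl⟩ := s
        rw [mem_pairOrthogonal, s.f_f, s.e_f]
        simp [(Fin.succ_ne_zero i).symm]⟩
      e_e := fun i j => s.1.e_e _ _
      f_f := fun i j => s.1.f_f _ _
      e_f := fun i j => (s.1.e_f i.succ j.succ).trans (by simp) }
  invFun t :=
    ⟨{ e := Fin.cons u fun i => (t.e i : V)
       f := Fin.cons v fun i => (t.f i : V)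
       e_e := fun i j => by
         have hl := fun i => (mem_pairOrthogonal.1 (t.e i).2).1
         have hr := fun i => (hB.neg u (t.e i : V)).symm
         refine Fin.cases ?_ (fun i => ?_) i <;> refine Fin.cases ?_ (fun j => ?_) j
         · simp [hB.self_eq_zero]
         · simp [hl]
         · simp [hr, hl]
         · exact t.e_e i j
       f_f := fun i j => by
         have hl := fun i => (mem_pairOrthogonal.1 (t.f i).2).2
         have hr := fun i => (hB.neg v (t.f i : V)).symm
         refine Fin.cases ?_ (fun i => ?_) i <;> refine Fin.cases ?_ (fun j => ?_) j
         · simp [hB.self_eq_zero]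
         · simp [hl]
         · simp [hr, hl]
         · exact t.f_f i j
       e_f := fun i j => by
         have hl := fun i => (mem_pairOrthogonal.1 (t.f i).2).1
         have hl' := fun i => (mem_pairOrthogonal.1 (t.e i).2).2
         have hr := fun i => (hB.neg v (t.e i : V)).symm
         refine Fin.cases ?_ (fun i => ?_) i <;> refine Fin.cases ?_ (fun j => ?_) j
         · simp [huv]
         · simp [hl, (Fin.succ_ne_zero j).symm]
         · simp [hr, hl']
         · simpa using (show B (t.e i) (t.f j) = _ from t.e_f i j) }, rfl, rfl⟩
  left_inv s := by
    obtain ⟨s, rfl, rfl⟩ := s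
    refine Subtype.ext (SymplecticFrame.ext ?_ ?_) <;> funext i <;>
      refine Fin.cases ?_ (fun i => ?_) i <;> rfl
  right_inv t := by
    refine SymplecticFrame.ext ?_ ?_ <;> rfl

instance [Finite V] (B : V →ₗ[F] V →ₗ[F] F) (r : ℕ) : Finite (SymplecticFrame B r) :=
  Finite.of_injective (fun s => (s.e, s.f)) fun _ _ h =>
    SymplecticFrame.ext (congrArg Prod.fst h) (congrArg Prod.snd h)

theorem card_apply_eq_one [Fintype F] [Finite V] {φ : V →ₗ[F] F} (hφ : φ ≠ 0) :
    Nat.card {x // φ x = 1} = Fintype.card F ^ (Module.finrank F V - 1) := by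
  obtain ⟨y, hy⟩ := LinearMap.surjective hφ 1
  have e : {x // φ x = 1} ≃ LinearMap.ker φ :=
    (Equiv.subRight y).subtypeEquiv fun x => by simp [hy, sub_eq_zero]
  have h := Module.Dual.finrank_ker_add_one_of_ne_zero (f := φ) hφ
  rw [Nat.card_congr e, Module.natCard_eq_pow_finrank (K := F), Nat.card_eq_fintype_card, ← h,
    Nat.add_sub_cancel]

theorem card_hyperbolicPair [Fintype F] [Finite V] {B : V →ₗ[F] V →ₗ[F] F}
    (hnd : ∀ x, (∀ y, B x y = 0) → x = 0) :
    Nat.card {p : V × V // B p.1 p.2 = 1} =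
      (Fintype.card F ^ Module.finrank F V - 1) *
        Fintype.card F ^ (Module.finrank F V - 1) := by
  classical
  have := Fintype.ofFinite V
  let e : {p : V × V // B p.1 p.2 = 1} ≃ Σ u : {u : V // u ≠ 0}, {v : V // B u v = 1} :=
    { toFun := fun p => ⟨⟨p.1.1, fun h => by simpa [h] using p.2⟩, p.1.2, p.2⟩
      invFun := fun s => ⟨(s.1, s.2), s.2.2⟩
      left_inv := fun _ => rfl
      right_inv := fun _ => rfl }
  have hne (u : {u : V // u ≠ 0}) : B u ≠ 0 := fun h => u.2 (hnd _ fun y => by simp [h])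
  rw [Nat.card_congr e, Nat.card_sigma, Finset.sum_congr rfl fun u _ => card_apply_eq_one (hne u),
    Finset.sum_const, smul_eq_mul, Finset.card_univ, Fintype.card_subtype_compl,
    Fintype.card_subtype_eq, Module.card_eq_pow_finrank (K := F) (V := V)]

end SymplecticFrame

theorem card_symplecticFrame {F : Type*} [Field F] [Fintype F] (r : ℕ) :
    ∀ {V : Type*} [AddCommGroup V] [Module F V] [Finite V] (B : V →ₗ[F] V →ₗ[F] F)
      (_ : B.IsAlt) (_ : ∀ x, (∀ y, B x y = 0) → x = 0) (_ : Module.finrank F V = 2 * r),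
      Nat.card (SymplecticFrame B r) =
        Fintype.card F ^ (r ^ 2) * ∏ i ∈ Finset.Icc 1 r, (Fintype.card F ^ (2 * i) - 1) := by
  induction r with
  | zero =>
    intro V _ _ _ B _ _ _
    have : Unique (SymplecticFrame B 0) :=
      { default := ⟨Fin.elim0, Fin.elim0, fun i => i.elim0, fun i => i.elim0, fun i => i.elim0⟩
        uniq := fun s => SymplecticFrame.ext (Subsingleton.elim _ _) (Subsingleton.elim _ _) }
    simp
  | succ r ih =>
    intro V _ _ _ B hB hnd hV
    have := Fintype.ofFinite {p : V × V // B p.1 p.2 = 1}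
    let φ : SymplecticFrame B (r + 1) → {p : V × V // B p.1 p.2 = 1} :=
      fun s => ⟨(s.e 0, s.f 0), by simpa using s.e_f 0 0⟩
    have hfib (p : {p : V × V // B p.1 p.2 = 1}) : Nat.card {s // φ s = p} =
        Fintype.card F ^ (r ^ 2) * ∏ i ∈ Finset.Icc 1 r, (Fintype.card F ^ (2 * i) - 1) := by
      obtain ⟨⟨u, v⟩, huv⟩ := p
      have e : {s // φ s = ⟨(u, v), huv⟩} ≃
          {s : SymplecticFrame B (r + 1) // s.e 0 = u ∧ s.f 0 = v} :=
        Equiv.subtypeEquivRight fun s => by simp [φ]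
      rw [Nat.card_congr (e.trans (SymplecticFrame.fiberEquiv hB huv r))]
      refine ih _ (fun x => hB x) (eq_zero_of_pairOrthogonal hB hnd huv) ?_
      have := finrank_pairOrthogonal hB huv
      omega
    rw [← Nat.card_congr (Equiv.sigmaFiberEquiv φ), Nat.card_sigma,
      Finset.sum_congr rfl fun p _ => hfib p, Finset.sum_const, smul_eq_mul, Finset.card_univ,
      ← Nat.card_eq_fintype_card, card_hyperbolicPair hnd, hV, Finset.prod_Icc_succ_top (by omega),
      show (r + 1) ^ 2 = (2 * (r + 1) - 1) + r ^ 2 by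
        rw [show 2 * (r + 1) - 1 = 2 * r + 1 by omega]; ring, pow_add]
    ring

section StandardForm

variable {F : Type*} [Field F] {r : ℕ}

variable (F r) in
/-- The standard symplectic form, with Gram matrix `[[0, 1], [-1, 0]]`. -/
abbrev standardForm : (Fin r ⊕ Fin r → F) →ₗ[F] (Fin r ⊕ Fin r → F) →ₗ[F] F :=
  toLinearMap₂' F (fromBlocks 0 1 (-1) 0)

theorem standardForm_apply (x y : Fin r ⊕ Fin r → F) :
    standardForm F r x y =
      ∑ i, (x (.inl i) * y (.inr i) - x (.inr i) * y (.inl i)) := by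
  simp [toLinearMap₂'_apply', fromBlocks_mulVec, dotProduct, neg_mulVec, sub_eq_add_neg,
    Finset.sum_add_distrib]

theorem isAlt_standardForm : (standardForm F r).IsAlt := fun x => by
  rw [standardForm_apply]
  exact Finset.sum_eq_zero fun i _ => by ring

theorem eq_zero_of_standardForm (x : Fin r ⊕ Fin r → F)
    (hx : ∀ y, standardForm F r x y = 0) : x = 0 := by
  funext i
  rcases i with i | i
  · simpa [standardForm_apply, Pi.single_apply] using hx (Pi.single (.inr i) 1)
  · simpa [standardForm_apply, Pi.single_apply] using hx (Pi.single (.inl i) 1)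

theorem transpose_mul_mul_apply {n : Type*} [Fintype n] [DecidableEq n] (g M : Matrix n n F)
    (i j : n) : (gᵀ * M * g) i j = toLinearMap₂' F M (gᵀ i) (gᵀ j) := by
  rw [toLinearMap₂'_apply', Matrix.mul_assoc]
  rfl

variable (F r) in
/-- A matrix is symplectic exactly when its columns form a symplectic frame. -/
def symplecticMatrixEquivFrame :
    {g : Matrix (Fin r ⊕ Fin r) (Fin r ⊕ Fin r) F //
      gᵀ * fromBlocks 0 1 (-1) 0 * g = fromBlocks 0 1 (-1) 0} ≃
      SymplecticFrame (standardForm F r) r where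
  toFun g :=
    { e := fun i => g.1ᵀ (.inl i)
      f := fun i => g.1ᵀ (.inr i)
      e_e := fun i j => by rw [← transpose_mul_mul_apply, g.2]; rfl
      f_f := fun i j => by rw [← transpose_mul_mul_apply, g.2]; rfl
      e_f := fun i j => by rw [← transpose_mul_mul_apply, g.2]; exact one_apply }
  invFun s :=
    ⟨(of (Sum.elim s.e s.f))ᵀ, by
      ext i j
      rw [transpose_mul_mul_apply, transpose_transpose]
      rcases i with i | i <;> rcases j with j | j
      · exact s.e_e i j
      · exact (s.e_f i j).trans one_apply.symm
      · refine (isAlt_standardForm.neg (s.e j) (s.f i)).symm.trans ?_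
        simp [s.e_f, one_apply, eq_comm]
      · exact s.f_f i j⟩
  left_inv g := by
    ext i j
    rcases j with j | j <;> rfl
  right_inv s := rfl

end StandardForm

/-- The order of the symplectic group `Sp_{2r}(F_q)` for odd `q > 2`:
`q^{r²} · ∏_{i=1}^{r} (q^{2i} - 1)`. -/
theorem stmt_4 (F : Type*) [Field F] [Fintype F] [DecidableEq F]
    (hq : 2 < Fintype.card F) (r : ℕ) (hr : 1 ≤ r) :
    Nat.card {g : Matrix (Fin r ⊕ Fin r) (Fin r ⊕ Fin r) F //
        gᵀ * Matrix.fromBlocks 0 1 (-1) 0 * g = Matrix.fromBlocks 0 1 (-1) 0} =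
      Fintype.card F ^ (r ^ 2) *
        ∏ i ∈ Finset.Icc 1 r, (Fintype.card F ^ (2 * i) - 1) := by
  rw [Nat.card_congr (symplecticMatrixEquivFrame F r)]
  refine card_symplecticFrame r _ isAlt_standardForm eq_zero_of_standardForm ?_
  simp [two_mul]
end

section
/- Let H be a finite group whose smallest degree of a nontrivial complex irreducible representation is δ. If A ⊆ H satisfies |A| > δ^{−1/3} |H|, then A·A·A = H. -/
open Pointwise

/-- Every nontrivial irreducible complex representation of `H` has dimension at least `δ`. -/
def MinRepDegreeGE (H : Type*) [Group H] (δ : ℕ) : Prop :=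
  ∀ (V : Type) (_ : AddCommGroup V) (_ : Module ℂ V)
    (_ : FiniteDimensional ℂ V) (ρ : Representation ℂ H V),
    (∃ g : H, ρ g ≠ LinearMap.id) →
    (∀ W : Submodule ℂ V, (∀ (g : H) (v : V), v ∈ W → ρ g v ∈ W) → W = ⊥ ∨ W = ⊤) →
    δ ≤ Module.finrank ℂ V

/-- The degree bound transfers to irreducible representations in an arbitrary universe. -/
theorem MinRepDegreeGE.le_finrank_of_irreducible {H : Type*} [Group H] {δ : ℕ}
    (h : MinRepDegreeGE H δ) {V : Type*} [AddCommGroup V] [Module ℂ V] [FiniteDimensional ℂ V]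
    (ρ : Representation ℂ H V) (hρ : ∃ g : H, ρ g ≠ LinearMap.id)
    (hirr : ∀ W : Submodule ℂ V, (∀ (g : H) (v : V), v ∈ W → ρ g v ∈ W) → W = ⊥ ∨ W = ⊤) :
    δ ≤ Module.finrank ℂ V := by
  let e := (Module.finBasis ℂ V).equivFun
  let σ : Representation ℂ H (Fin (Module.finrank ℂ V) → ℂ) :=
    { toFun := fun g => e.conj (ρ g)
      map_one' := by ext; simp [LinearEquiv.conj_apply]
      map_mul' := fun g g' => by ext; simp [LinearEquiv.conj_apply] }
  have hσ : ∀ g v, σ g (e v) = e (ρ g v) := fun g v => by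
    change e.conj (ρ g) (e v) = _
    simp [LinearEquiv.conj_apply]
  have key := h (Fin (Module.finrank ℂ V) → ℂ) _ _ inferInstance σ ?_ ?_
  · simpa using key
  · obtain ⟨g, hg⟩ := hρ
    refine ⟨g, fun hid => hg ?_⟩
    ext v
    apply e.injective
    rw [← hσ, hid]
    rfl
  · intro W hW
    have hcomap := hirr (W.comap e.toLinearMap) (fun g v hv => by
      have := hW g (e v) hv
      rw [hσ] at this
      exact this)
    have hmap : W = (W.comap e.toLinearMap).map e.toLinearMap :=
      (Submodule.map_comap_eq_of_surjective e.surjective W).symm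
    rcases hcomap with h0 | h1
    · left; rw [hmap, h0, Submodule.map_bot]
    · right; rw [hmap, h1, Submodule.map_top, LinearMap.range_eq_top]; exact e.surjective

/-- A nonzero invariant subspace without nonzero fixed vectors has dimension at least `δ`. -/
theorem MinRepDegreeGE.le_finrank_of_invariant {H : Type*} [Group H] {δ : ℕ}
    (h : MinRepDegreeGE H δ) {V : Type*} [AddCommGroup V] [Module ℂ V] [FiniteDimensional ℂ V]
    (ρ : Representation ℂ H V) (E : Submodule ℂ V) (hE : E ≠ ⊥)
    (hinv : ∀ (g : H) (v : V), v ∈ E → ρ g v ∈ E)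
    (hfix : ∀ v ∈ E, (∀ g, ρ g v = v) → v = 0) :
    δ ≤ Module.finrank ℂ E := by
  induction hd : Module.finrank ℂ E using Nat.strong_induction_on generalizing E with
  | _ d ih =>
    subst hd
    by_cases hex : ∃ W : Submodule ℂ V, W ≠ ⊥ ∧ W < E ∧ ∀ (g : H) (v : V), v ∈ W → ρ g v ∈ W
    · obtain ⟨W, hW, hWE, hWinv⟩ := hex
      have hlt := Submodule.finrank_lt_finrank_of_lt hWE
      exact (ih _ hlt W hW hWinv (fun v hv => hfix v (hWE.le hv)) rfl).trans hlt.le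
    · push Not at hex
      refine h.le_finrank_of_irreducible (ρ.subrepresentation E fun g v hv => hinv g v hv) ?_ ?_
      · by_contra! hall
        obtain ⟨v, hv, hv0⟩ := E.ne_bot_iff.1 hE
        refine hv0 (hfix v hv fun g => ?_)
        exact congrArg Subtype.val (LinearMap.congr_fun (hall g) ⟨v, hv⟩)
      · intro W hW
        by_contra! hne
        obtain ⟨hne0, hne1⟩ := hne
        obtain ⟨g, v, hv, hgv⟩ := hex (W.map E.subtype)
          (fun heq => hne0 <| Submodule.map_injective_of_injective E.injective_subtype <| by
            rw [heq, Submodule.map_bot])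
          (by
            refine lt_of_le_of_ne (Submodule.map_subtype_le E W) fun heq => hne1 ?_
            apply Submodule.map_injective_of_injective E.injective_subtype
            rw [heq, Submodule.map_subtype_top])
        obtain ⟨w, hw, rfl⟩ := hv
        exact hgv ⟨_, hW g w hw, rfl⟩

/-- The squared singular values of `T`, with multiplicity, are bounded by the squared
Hilbert–Schmidt norm of `T`. -/
theorem finrank_eigenspace_mul_le {ι E : Type*} [Fintype ι] [NormedAddCommGroup E]
    [InnerProductSpace ℂ E] [FiniteDimensional ℂ E] (b : OrthonormalBasis ι ℂ E)
    (T : E →ₗ[ℂ] E) (μ : ℝ) :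
    (Module.finrank ℂ (Module.End.eigenspace (LinearMap.adjoint T * T) (μ : ℂ)) : ℝ) * μ
      ≤ ∑ i, ‖LinearMap.adjoint T (b i)‖ ^ 2 := by
  set W := Module.End.eigenspace (LinearMap.adjoint T * T) (μ : ℂ)
  let u := stdOrthonormalBasis ℂ W
  have hu : Orthonormal ℂ (fun i => (u i : E)) :=
    u.orthonormal.comp_linearIsometry W.subtypeₗᵢ
  have hnorm : ∀ i, ‖T (u i)‖ ^ 2 = μ := fun i => by
    have h1 : LinearMap.adjoint T (T (u i)) = (μ : ℂ) • (u i : E) :=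
      Module.End.mem_eigenspace_iff.1 (u i).2
    have h2 : inner ℂ (T (u i)) (T (u i)) = (μ : ℂ) := by
      rw [← LinearMap.adjoint_inner_right, h1, inner_smul_right, inner_self_eq_norm_sq_to_K,
        hu.1 i]
      simp
    rw [inner_self_eq_norm_sq_to_K] at h2
    exact Complex.ofReal_injective (by push_cast; exact h2)
  calc (Module.finrank ℂ W : ℝ) * μ = ∑ i, ‖T (u i)‖ ^ 2 := by simp [hnorm]
    _ = ∑ i, ∑ j, ‖inner ℂ (b j) (T (u i))‖ ^ 2 := by simp [b.sum_sq_norm_inner_right]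
    _ = ∑ j, ∑ i, ‖inner ℂ (u i : E) (LinearMap.adjoint T (b j))‖ ^ 2 := by
      rw [Finset.sum_comm]
      refine Finset.sum_congr rfl fun j _ => Finset.sum_congr rfl fun i _ => ?_
      rw [LinearMap.adjoint_inner_right, norm_inner_symm]
    _ ≤ _ := Finset.sum_le_sum fun j _ => hu.sum_inner_products_le _

/-- If all eigenvalues of `T* T` are at most `c`, then `‖T f‖² ≤ c ‖f‖²`. -/
theorem norm_sq_apply_le_of_eigenvalue_le {E : Type*} [NormedAddCommGroup E]
    [InnerProductSpace ℂ E] [FiniteDimensional ℂ E] (T : E →ₗ[ℂ] E) (c : ℝ)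
    (hc : ∀ μ : ℝ, Module.End.eigenspace (LinearMap.adjoint T * T) (μ : ℂ) ≠ ⊥ → μ ≤ c) (f : E) :
    ‖T f‖ ^ 2 ≤ c * ‖f‖ ^ 2 := by
  have hM := LinearMap.isSymmetric_adjoint_mul_self T
  let b := hM.eigenvectorBasis rfl
  let ev := hM.eigenvalues rfl
  have hb : ∀ i, (LinearMap.adjoint T * T) (b i) = ((ev i : ℝ) : ℂ) • b i :=
    hM.apply_eigenvectorBasis rfl
  have hev : ∀ i, ev i ≤ c := fun i => hc _ <| (Submodule.ne_bot_iff _).2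
    ⟨b i, Module.End.mem_eigenspace_iff.2 (hb i), b.orthonormal.ne_zero i⟩
  have hsum : ((‖T f‖ ^ 2 : ℝ) : ℂ) = ((∑ i, ev i * ‖inner ℂ (b i) f‖ ^ 2 : ℝ) : ℂ) := by
    have h1 : inner ℂ f ((LinearMap.adjoint T * T) f) = ((‖T f‖ ^ 2 : ℝ) : ℂ) := by
      rw [Module.End.mul_apply, LinearMap.adjoint_inner_right, inner_self_eq_norm_sq_to_K]
      simp
    rw [← h1, ← b.sum_inner_mul_inner]
    push_cast
    refine Finset.sum_congr rfl fun i _ => ?_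
    rw [← hM (b i) f, hb, inner_smul_left, Complex.conj_ofReal, ← inner_conj_symm f (b i),
      mul_left_comm, RCLike.conj_mul]
    rfl
  rw [Complex.ofReal_injective hsum, ← b.sum_sq_norm_inner_right f, Finset.mul_sum]
  gcongr with i
  exact hev i

/-- The right regular representation on `ℓ²(H)`. -/
def rightRegular (H : Type*) [Group H] : Representation ℂ H (EuclideanSpace ℂ H) where
  toFun h :=
    { toFun := fun f => WithLp.toLp 2 fun x => f (x * h)
      map_add' := fun _ _ => rfl
      map_smul' := fun _ _ => rfl }
  map_one' := by ext f x; simp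
  map_mul' g h := by
    ext f x
    exact congrArg f.ofLp (mul_assoc x g h).symm

theorem rightRegular_apply {H : Type*} [Group H] (h : H) (f : EuclideanSpace ℂ H) (x : H) :
    rightRegular H h f x = f (x * h) := rfl

section Convolution

variable {H : Type*} [Group H] [Fintype H] [DecidableEq H]

/-- Left convolution by `φ`, as an operator on `ℓ²(H)`. -/
noncomputable def convOp (φ : H → ℂ) : EuclideanSpace ℂ H →ₗ[ℂ] EuclideanSpace ℂ H :=
  Matrix.toEuclideanLin (Matrix.of fun x y => φ (x * y⁻¹))

theorem convOp_apply (φ : H → ℂ) (f : EuclideanSpace ℂ H) (x : H) :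
    convOp φ f x = ∑ y, φ (x * y⁻¹) * f y := rfl

theorem adjoint_convOp (φ : H → ℂ) :
    LinearMap.adjoint (convOp φ) = convOp fun z => star (φ z⁻¹) := by
  rw [convOp, ← Matrix.toEuclideanLin_conjTranspose_eq_adjoint, convOp]
  congr 1
  ext x y
  simp [Matrix.conjTranspose_apply]

theorem convOp_rightRegular (φ : H → ℂ) (h : H) (f : EuclideanSpace ℂ H) :
    convOp φ (rightRegular H h f) = rightRegular H h (convOp φ f) := by
  ext x
  simp only [convOp_apply, rightRegular_apply]
  exact Fintype.sum_equiv (Equiv.mulRight h) _ _ fun y => by simp [mul_assoc]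

theorem convOp_eq_zero_of_fixed {φ : H → ℂ} (hφ : ∑ x, φ x = 0) {f : EuclideanSpace ℂ H}
    (hf : ∀ h, rightRegular H h f = f) : convOp φ f = 0 := by
  have hconst : ∀ y, f y = f 1 := fun y => by
    conv_rhs => rw [← hf y]
    simp [rightRegular_apply]
  ext x
  rw [convOp_apply]
  simp_rw [hconst, ← Finset.sum_mul]
  rw [Fintype.sum_equiv ((Equiv.inv H).trans (Equiv.mulLeft x)) _ φ fun y => by simp, hφ]
  simp

theorem sum_norm_sq_convOp_single (φ : H → ℂ) :
    ∑ x : H, ‖convOp φ (EuclideanSpace.basisFun H ℂ x)‖ ^ 2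
      = Fintype.card H * ∑ x, ‖φ x‖ ^ 2 := by
  have h : ∀ x : H, ‖convOp φ (EuclideanSpace.basisFun H ℂ x)‖ ^ 2 = ∑ z, ‖φ z‖ ^ 2 := by
    intro x
    rw [EuclideanSpace.norm_sq_eq]
    refine Fintype.sum_equiv (Equiv.mulRight x⁻¹) _ _ fun y => ?_
    simp [convOp_apply]
  rw [Finset.sum_congr rfl fun x _ => h x]
  simp

/-- Convolution by a function of mean zero on a quasirandom group has small operator norm. -/
theorem MinRepDegreeGE.norm_sq_convOp_le {δ : ℕ} (hδ : 0 < δ) (h : MinRepDegreeGE H δ)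
    {φ : H → ℂ} (hφ : ∑ x, φ x = 0) (f : EuclideanSpace ℂ H) :
    ‖convOp φ f‖ ^ 2 ≤ (Fintype.card H * ∑ x, ‖φ x‖ ^ 2) / δ * ‖f‖ ^ 2 := by
  refine norm_sq_apply_le_of_eigenvalue_le _ _ (fun μ hμ => ?_) f
  have hδ' : (0 : ℝ) < δ := by exact_mod_cast hδ
  rcases le_or_gt μ 0 with hμ0 | hμ0
  · exact hμ0.trans (by positivity)
  have hdim := h.le_finrank_of_invariant (rightRegular H) _ hμ
    (fun g v hv => by
      rw [Module.End.mem_eigenspace_iff, Module.End.mul_apply] at hv ⊢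
      rw [adjoint_convOp] at hv ⊢
      rw [convOp_rightRegular, convOp_rightRegular, hv, map_smul])
    (fun v hv hfix => by
      rw [Module.End.mem_eigenspace_iff, Module.End.mul_apply,
        convOp_eq_zero_of_fixed hφ hfix, map_zero] at hv
      exact (smul_eq_zero.1 hv.symm).resolve_left (by exact_mod_cast hμ0.ne'))
  rw [le_div_iff₀ hδ', mul_comm]
  calc (δ : ℝ) * μ ≤ _ := mul_le_mul_of_nonneg_right (Nat.cast_le.2 hdim) hμ0.le
    _ ≤ _ := finrank_eigenspace_mul_le (EuclideanSpace.basisFun H ℂ) _ μ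
    _ = _ := by
      rw [adjoint_convOp, sum_norm_sq_convOp_single]
      congr 1
      exact Fintype.sum_equiv (Equiv.inv H) _ _ fun x => by simp

/-- A set whose triple product misses an element of a quasirandom group is small. -/
theorem MinRepDegreeGE.card_pow_three_le {δ : ℕ} (hδ : 0 < δ) (h : MinRepDegreeGE H δ)
    (A : Finset H) {g : H} (hg : g ∉ A * A * A) :
    (δ : ℝ) * (A.card : ℝ) ^ 3 ≤ (Fintype.card H : ℝ) ^ 3 := by
  have hδ' : (0 : ℝ) < δ := by exact_mod_cast hδ
  set n : ℝ := (Fintype.card H : ℝ) with hn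
  set a : ℝ := (A.card : ℝ) with ha
  have hn0 : 0 < n := by rw [hn]; exact_mod_cast Fintype.card_pos
  have ha0 : 0 ≤ a := by positivity
  rcases ha0.eq_or_lt with h0 | ha0
  · rw [← h0]; simp; positivity
  let ψ : H → ℝ := fun x => (if x ∈ A then 1 else 0) - a / n
  let φ : H → ℂ := fun x => (ψ x : ℂ)
  have hψ : ∑ x, ψ x = 0 := by
    simp only [ψ, Finset.sum_sub_distrib, Finset.sum_ite_mem, Finset.univ_inter,
      Finset.sum_const, nsmul_eq_mul, Finset.card_univ, ← hn, ← ha]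
    field_simp
    ring
  have hφ : ∑ x, φ x = 0 := by simp only [φ, ← Complex.ofReal_sum, hψ, Complex.ofReal_zero]
  have hφ2 : ∑ x, ‖φ x‖ ^ 2 ≤ a := by
    have hsq : ∀ x, ‖φ x‖ ^ 2 = (if x ∈ A then 1 else 0) - (a / n) * (if x ∈ A then 1 else 0)
        - (a / n) * ψ x := fun x => by
      simp only [φ, Complex.norm_real, Real.norm_eq_abs, sq_abs, ψ]
      split_ifs <;> ring
    simp only [hsq, Finset.sum_sub_distrib, ← Finset.mul_sum, hψ, Finset.sum_ite_mem,
      Finset.univ_inter, Finset.sum_const, nsmul_eq_mul, ← ha]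
    have : 0 ≤ a / n * a := by positivity
    linarith
  let f : EuclideanSpace ℂ H := WithLp.toLp 2 fun x => if x ∈ A then 1 else 0
  have hf : ‖f‖ ^ 2 = a := by
    rw [EuclideanSpace.norm_sq_eq]
    simp [f, apply_ite, ha]
  have hval : ∀ c ∈ A, convOp φ f (g * c⁻¹) = ((-(a / n) * a : ℝ) : ℂ) := fun c hc => by
    rw [convOp_apply]
    have : ∀ y, φ (g * c⁻¹ * y⁻¹) * f y = if y ∈ A then ((-(a / n) : ℝ) : ℂ) else 0 := by
      intro y
      by_cases hy : y ∈ A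
      · have hmem : g * c⁻¹ * y⁻¹ ∉ A := fun hmem => hg <| by
          simpa using Finset.mul_mem_mul (Finset.mul_mem_mul hmem hy) hc
        simp [φ, ψ, f, hy, hmem]
      · simp [f, hy]
    simp only [this, Finset.sum_ite_mem, Finset.univ_inter, Finset.sum_const, nsmul_eq_mul]
    rw [ha]
    push_cast
    ring
  have hlow : a * ((a / n) * a) ^ 2 ≤ ‖convOp φ f‖ ^ 2 := by
    rw [EuclideanSpace.norm_sq_eq]
    calc a * ((a / n) * a) ^ 2 = ∑ c ∈ A, ‖convOp φ f (g * c⁻¹)‖ ^ 2 := by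
          rw [Finset.sum_congr rfl fun c hc => by rw [hval c hc, Complex.norm_real,
            Real.norm_eq_abs, sq_abs]]
          simp only [Finset.sum_const, nsmul_eq_mul, ← ha]
          ring
      _ ≤ ∑ c, ‖convOp φ f (g * c⁻¹)‖ ^ 2 :=
          Finset.sum_le_sum_of_subset_of_nonneg (Finset.subset_univ _) fun _ _ _ => by positivity
      _ = _ := Fintype.sum_equiv ((Equiv.inv H).trans (Equiv.mulLeft g)) _ _ fun c => by simp
  have hup : ‖convOp φ f‖ ^ 2 ≤ (n * a) / δ * a := by
    refine (h.norm_sq_convOp_le hδ hφ f).trans ?_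
    rw [hf]
    gcongr
  have hle := hlow.trans hup
  have e1 : a * ((a / n) * a) ^ 2 = (δ * a ^ 3) * (a ^ 2 / (n ^ 2 * δ)) := by field_simp
  have e2 : (n * a) / δ * a = n ^ 3 * (a ^ 2 / (n ^ 2 * δ)) := by field_simp
  rw [e1, e2] at hle
  exact le_of_mul_le_mul_right hle (by positivity)

end Convolution

/-- The Nikolov–Pyber/Gowers trick: if every nontrivial irreducible complex
representation of a finite group `H` has dimension at least `δ` and
`|A| > δ^{-1/3}|H|`, then `A·A·A = H`. -/
theorem stmt_15 (H : Type*) [Group H] [Fintype H] [DecidableEq H]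
    (δ : ℕ) (hδ : 0 < δ)
    (hmin : ∀ (V : Type) (_ : AddCommGroup V) (_ : Module ℂ V)
      (_ : FiniteDimensional ℂ V) (ρ : Representation ℂ H V),
      (∃ g : H, ρ g ≠ LinearMap.id) →
      (∀ W : Submodule ℂ V, (∀ (g : H) (v : V), v ∈ W → ρ g v ∈ W) → W = ⊥ ∨ W = ⊤) →
      δ ≤ Module.finrank ℂ V)
    (A : Finset H)
    (hA : (δ : ℝ) ^ (-(1 : ℝ) / 3) * (Fintype.card H : ℝ) < (A.card : ℝ)) :
    A * A * A = Finset.univ := by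
  have h : MinRepDegreeGE H δ := hmin
  refine Finset.eq_univ_iff_forall.2 fun g => by_contra fun hg => ?_
  have hδ' : (0 : ℝ) < δ := by exact_mod_cast hδ
  have hpow : ((δ : ℝ) ^ (-(1 : ℝ) / 3)) ^ 3 = (δ : ℝ)⁻¹ := by
    rw [← Real.rpow_natCast, ← Real.rpow_mul hδ'.le]
    norm_num [Real.rpow_neg_one]
  have h3 := pow_lt_pow_left₀ hA (by positivity) three_ne_zero
  rw [mul_pow, hpow, inv_mul_lt_iff₀ hδ'] at h3
  exact absurd (h.card_pow_three_le hδ A hg) h3.not_ge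
end
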